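/- Let α > 1/2 and β > -1. Then max_{θ ∈ [π/2, π]} sin(θ/2) |P_n^{(α,β)}(cos θ)| ≲ n^{max(β, -1/2)} as n → ∞. -/

import Mathlib

open Real Set

/-- Jacobi polynomial `P_n^{(a,b)}` in the standard normalization. -/
noncomputable def jacobiP (a b : ℝ) (n : ℕ) (x : ℝ) : ℝ :=
  (Nat.factorial n : ℝ)⁻¹ *
    ∑ k ∈ Finset.range (n + 1),
      (Nat.choose n k : ℝ) * (ascPochhammer ℝ k).eval ((n : ℝ) + a + b + 1) *
        (ascPochhammer ℝ (n - k)).eval (a + (k : ℝ) + 1) * ((x - 1) / 2) ^ k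

/-- Pochhammer symbol `(q)_n` for real `q`. -/
noncomputable def poch (q : ℝ) (n : ℕ) : ℝ := (ascPochhammer ℝ n).eval q

open Polynomial in
theorem ascPochhammer_succ_eval_left (n : ℕ) (x : ℝ) :
    (ascPochhammer ℝ (n + 1)).eval x = x * (ascPochhammer ℝ n).eval (x + 1) := by
  simp [ascPochhammer_succ_left, eval_comp]

/-- The coefficient of `((x - 1) / 2) ^ k` in `P_n^{(a,b)}(x)`. -/
noncomputable def jacobiCoeff (a b : ℝ) (n k : ℕ) : ℝ :=
  (n.factorial : ℝ)⁻¹ * ((n.choose k : ℝ) * (ascPochhammer ℝ k).eval ((n : ℝ) + a + b + 1) *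
    (ascPochhammer ℝ (n - k)).eval (a + (k : ℝ) + 1))

/-- The polynomial in `z = (x - 1) / 2` equal to `P_n^{(a,b)}(x)`. -/
noncomputable def jacobiPoly (a b : ℝ) (n : ℕ) : Polynomial ℝ :=
  ∑ k ∈ Finset.range (n + 1), Polynomial.monomial k (jacobiCoeff a b n k)

theorem jacobiP_eq_eval (a b : ℝ) (n : ℕ) (x : ℝ) :
    jacobiP a b n x = (jacobiPoly a b n).eval ((x - 1) / 2) := by
  simp [jacobiP, jacobiPoly, jacobiCoeff, Polynomial.eval_finsetSum, Finset.mul_sum, mul_assoc]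

theorem jacobiPoly_coeff (a b : ℝ) (n k : ℕ) :
    (jacobiPoly a b n).coeff k = jacobiCoeff a b n k := by
  rw [jacobiPoly, Polynomial.finsetSum_coeff]
  simp only [Polynomial.coeff_monomial, Finset.sum_ite_eq', Finset.mem_range]
  split_ifs with h
  · rfl
  · simp [jacobiCoeff, Nat.choose_eq_zero_of_lt (show n < k by omega)]

theorem jacobiCoeff_succ (a b : ℝ) (n k : ℕ) :
    (k + 1) * (a + k + 1) * jacobiCoeff a b n (k + 1) =
      (n - k) * (n + a + b + 1 + k) * jacobiCoeff a b n k := by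
  rcases lt_trichotomy k n with h | rfl | h
  · obtain ⟨m, rfl⟩ : ∃ m, n = k + 1 + m := ⟨n - k - 1, by omega⟩
    have hc : (((k + 1 + m).choose (k + 1) : ℕ) : ℝ) * (k + 1) =
        ((k + 1 + m).choose k : ℕ) * (m + 1) := by
      have := Nat.choose_succ_right_eq (k + 1 + m) k
      rw [show k + 1 + m - k = m + 1 by omega] at this
      exact_mod_cast this
    simp only [jacobiCoeff, ascPochhammer_succ_eval, show k + 1 + m - (k + 1) = m by omega,
      show k + 1 + m - k = m + 1 by omega, ascPochhammer_succ_eval_left m]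
    push_cast
    rw [show a + (k + 1 : ℝ) + 1 = a + k + 1 + 1 by ring]
    linear_combination ((k + 1 + m).factorial : ℝ)⁻¹ * (a + k + 1) *
      (ascPochhammer ℝ k).eval ((k + 1 + m : ℝ) + a + b + 1) * ((k + 1 + m : ℝ) + a + b + 1 + k) *
      (ascPochhammer ℝ m).eval (a + k + 1 + 1) * hc
  · simp [jacobiCoeff]
  · simp [jacobiCoeff, Nat.choose_eq_zero_of_lt h,
      Nat.choose_eq_zero_of_lt (show n < k + 1 by omega)]

theorem jacobiCoeff_succ_succ (a b : ℝ) (n k : ℕ) :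
    (k + 1) * jacobiCoeff a b (n + 1) (k + 1) =
      (n + 1 + a + b + 1) * jacobiCoeff (a + 1) (b + 1) n k := by
  have hc : (((n + 1).choose (k + 1) : ℕ) : ℝ) * (k + 1) = (n + 1) * (n.choose k : ℕ) := by
    exact_mod_cast (Nat.add_one_mul_choose_eq n k).symm
  simp only [jacobiCoeff, ascPochhammer_succ_eval_left, Nat.add_sub_add_right, Nat.factorial_succ]
  push_cast
  rw [show a + (k + 1 : ℝ) + 1 = a + 1 + k + 1 by ring,
    show (n + 1 : ℝ) + a + b + 1 + 1 = n + (a + 1) + (b + 1) + 1 by ring]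
  have h1 : (n + 1 : ℝ) ≠ 0 := by positivity
  have h2 : (n.factorial : ℝ) ≠ 0 := by positivity
  field_simp
  linear_combination (n + 1 + a + b + 1 : ℝ) * (ascPochhammer ℝ (n - k)).eval (a + 1 + k + 1) *
    (ascPochhammer ℝ k).eval ((n : ℝ) + (a + 1) + (b + 1) + 1) * hc

open Polynomial in
theorem derivative_jacobiPoly (a b : ℝ) (n : ℕ) :
    derivative (jacobiPoly a b (n + 1)) =
      C (n + 1 + a + b + 1 : ℝ) * jacobiPoly (a + 1) (b + 1) n := by
  ext k
  rw [coeff_derivative, coeff_C_mul, jacobiPoly_coeff, jacobiPoly_coeff, ← jacobiCoeff_succ_succ]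
  ring

open Polynomial in
theorem jacobiPoly_ode (a b : ℝ) (n : ℕ) :
    X * derivative (derivative (jacobiPoly a b n)) +
      X * (X * derivative (derivative (jacobiPoly a b n))) +
      C (a + 1) * derivative (jacobiPoly a b n) +
      C (a + b + 2) * (X * derivative (jacobiPoly a b n)) =
      C (n * (n + a + b + 1) : ℝ) * jacobiPoly a b n := by
  ext k
  rcases k with _ | _ | k
  · have := jacobiCoeff_succ a b n 0
    simp [coeff_derivative, jacobiPoly_coeff, mul_coeff_zero] at this ⊢
    linear_combination this
  · have := jacobiCoeff_succ a b n 1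
    simp only [coeff_add, coeff_C_mul, coeff_X_mul, coeff_derivative, jacobiPoly_coeff,
      mul_coeff_zero, coeff_X_zero]
    push_cast at this ⊢
    linear_combination this
  · have := jacobiCoeff_succ a b n (k + 2)
    simp only [coeff_add, coeff_C_mul, coeff_X_mul, coeff_derivative, jacobiPoly_coeff]
    push_cast at this ⊢
    linear_combination this

/-- `P_n^{(a,b)}` as a function of `w = (1 + x) / 2`. -/
noncomputable def jacobiW (a b : ℝ) (n : ℕ) (w : ℝ) : ℝ := (jacobiPoly a b n).eval (w - 1)

theorem hasDerivAt_eval_sub_one (p : Polynomial ℝ) (w : ℝ) :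
    HasDerivAt (fun w : ℝ => p.eval (w - 1)) ((Polynomial.derivative p).eval (w - 1)) w := by
  exact (p.hasDerivAt (w - 1)).comp_sub_const w 1

/-- Jacobi functions solve the hypergeometric equation. -/
theorem exists_deriv_jacobiW (a b : ℝ) (n : ℕ) :
    ∃ y₁ y₂ : ℝ → ℝ, (∀ w, HasDerivAt (jacobiW a b n) (y₁ w) w) ∧
      (∀ w, HasDerivAt y₁ (y₂ w) w) ∧
      ∀ w, w * (1 - w) * y₂ w + (b + 1 - (a + b + 2) * w) * y₁ w +
        n * (n + a + b + 1) * jacobiW a b n w = 0 := by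
  refine ⟨_, _, fun w => hasDerivAt_eval_sub_one _ w, fun w => hasDerivAt_eval_sub_one _ w,
    fun w => ?_⟩
  have := congrArg (Polynomial.eval (w - 1)) (jacobiPoly_ode a b n)
  simp only [Polynomial.eval_add, Polynomial.eval_mul, Polynomial.eval_C, Polynomial.eval_X] at this
  rw [jacobiW]
  linear_combination -this

theorem hasDerivAt_jacobiW (a b : ℝ) (n : ℕ) (w : ℝ) :
    HasDerivAt (jacobiW a b (n + 1)) ((n + 1 + a + b + 1) * jacobiW (a + 1) (b + 1) n w) w := by
  have := hasDerivAt_eval_sub_one (jacobiPoly a b (n + 1)) w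
  rwa [derivative_jacobiPoly, Polynomial.eval_mul, Polynomial.eval_C] at this

theorem jacobiW_zero {a b : ℝ} (hab : 0 < a + b + 1) (n : ℕ) :
    jacobiW a b n 0 = (-1) ^ n * ((n.factorial : ℝ)⁻¹ * (ascPochhammer ℝ n).eval (b + 1)) := by
  induction n generalizing a b with
  | zero => simp [jacobiW, jacobiPoly, jacobiCoeff]
  | succ n ih =>
    obtain ⟨y₁, y₂, h₁, -, h⟩ := exists_deriv_jacobiW a b (n + 1)
    have h0 := h 0
    rw [(h₁ 0).unique (hasDerivAt_jacobiW a b n 0),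
      ih (show 0 < a + 1 + (b + 1) + 1 by linarith)] at h0
    have hn : (0 : ℝ) < n + 1 + a + b + 1 := by linarith [n.cast_nonneg (α := ℝ)]
    have h2 : (n.factorial : ℝ) ≠ 0 := by positivity
    rw [ascPochhammer_succ_eval_left, Nat.factorial_succ]
    push_cast at h0 ⊢
    have hn' : (n + 1 : ℝ) ≠ 0 := by positivity
    refine mul_left_cancel₀ (mul_ne_zero hn' hn.ne') ?_
    have hi : (n + 1 : ℝ) * ((n + 1) * n.factorial : ℝ)⁻¹ = (n.factorial : ℝ)⁻¹ := by field_simp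
    linear_combination h0 + (n + 1 + a + b + 1 : ℝ) * (-1) ^ n * (b + 1) *
      (ascPochhammer ℝ n).eval (b + 1 + 1) * hi

theorem ascPochhammer_div_factorial_le {b : ℝ} (hb : -1 < b) {n : ℕ} (hn : n ≠ 0) :
    (n.factorial : ℝ)⁻¹ * (ascPochhammer ℝ n).eval (b + 1) ≤ exp |b| * (n : ℝ) ^ b := by
  have key : ∀ m : ℕ, (m.factorial : ℝ)⁻¹ * (ascPochhammer ℝ m).eval (b + 1) ≤
      exp (b * (harmonic m : ℚ)) := by
    intro m
    induction m with
    | zero => simp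
    | succ m ih =>
      have hm : (0 : ℝ) < m + 1 := by positivity
      have h1 : 1 + b / (m + 1) ≤ exp (b / (m + 1)) := by
        linarith [add_one_le_exp (b / (m + 1 : ℝ))]
      have h0 : 0 ≤ 1 + b / (m + 1) := by
        rw [one_add_div hm.ne']
        exact div_nonneg (by linarith [m.cast_nonneg (α := ℝ)]) hm.le
      have e1 : ((m + 1).factorial : ℝ)⁻¹ * (ascPochhammer ℝ (m + 1)).eval (b + 1) =
          (m.factorial : ℝ)⁻¹ * (ascPochhammer ℝ m).eval (b + 1) * (1 + b / (m + 1)) := by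
        rw [ascPochhammer_succ_eval, Nat.factorial_succ]
        push_cast
        have h2 : (m.factorial : ℝ) ≠ 0 := by positivity
        field_simp
        ring
      rw [e1, harmonic_succ]
      push_cast
      rw [mul_add b, exp_add, ← div_eq_mul_inv]
      exact mul_le_mul ih h1 h0 (exp_pos _).le
  refine (key n).trans ?_
  have hn' : (0 : ℝ) < n := by positivity
  rw [rpow_def_of_pos hn', ← exp_add, exp_le_exp]
  have hu := harmonic_le_one_add_log n
  have hl : Real.log n ≤ harmonic n :=
    (Real.log_le_log hn' (by push_cast; linarith)).trans (log_add_one_le_harmonic n)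
  rcases le_total 0 b with h | h
  · rw [abs_of_nonneg h]; nlinarith
  · rw [abs_of_nonpos h]; nlinarith

theorem abs_jacobiW_zero_le {a b : ℝ} (hab : 0 < a + b + 1) (hb : -1 < b) {n : ℕ} (hn : n ≠ 0) :
    |jacobiW a b n 0| ≤ exp |b| * (n : ℝ) ^ b := by
  rw [jacobiW_zero hab, abs_mul, abs_pow, abs_neg, abs_one, one_pow, one_mul, abs_of_nonneg]
  · exact ascPochhammer_div_factorial_le hb hn
  · exact mul_nonneg (by positivity) (ascPochhammer_pos n (b + 1) (by linarith)).le

/-- Grönwall's inequality with a general integrating factor. -/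
theorem le_mul_exp_of_hasDerivAt_le {h h' φ φ' : ℝ → ℝ} {u v : ℝ} (huv : u ≤ v)
    (hh : ∀ x ∈ Icc u v, HasDerivAt h (h' x) x) (hφ : ∀ x ∈ Icc u v, HasDerivAt φ (φ' x) x)
    (hle : ∀ x ∈ Icc u v, h' x ≤ φ' x * h x) : h v ≤ h u * exp (φ v - φ u) := by
  have hd : ∀ x ∈ Icc u v, HasDerivAt (fun x => h x * exp (-φ x))
      (h' x * exp (-φ x) + h x * (exp (-φ x) * -φ' x)) x := fun x hx =>
    (hh x hx).mul (hφ x hx).neg.exp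
  have hanti : AntitoneOn (fun x => h x * exp (-φ x)) (Icc u v) := by
    refine antitoneOn_of_deriv_nonpos (convex_Icc u v)
      (fun x hx => (hd x hx).continuousAt.continuousWithinAt)
      (fun x hx => (hd x (interior_subset hx)).differentiableAt.differentiableWithinAt)
      fun x hx => ?_
    rw [(hd x (interior_subset hx)).deriv]
    nlinarith [hle x (interior_subset hx), exp_pos (-φ x)]
  have := hanti (left_mem_Icc.2 huv) (right_mem_Icc.2 huv) huv
  simp only at this
  calc h v = h v * exp (-φ v) * exp (φ v) := by rw [mul_assoc, ← exp_add]; simp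
    _ ≤ h u * exp (-φ u) * exp (φ v) := by gcongr
    _ = _ := by rw [mul_assoc, ← exp_add]; ring_nf

/-- Derivative of the Sonin energy of a solution of the hypergeometric equation. -/
theorem hasDerivAt_soninEnergy {a b l w : ℝ} {y y₁ y₂ : ℝ → ℝ} (h₁ : HasDerivAt y (y₁ w) w)
    (h₂ : HasDerivAt y₁ (y₂ w) w)
    (ode : w * (1 - w) * y₂ w + (b + 1 - (a + b + 2) * w) * y₁ w + l * y w = 0) :
    HasDerivAt (fun w => l * y w ^ 2 + w * (1 - w) * y₁ w ^ 2)
      ((2 * (a + b + 1) * w - (2 * b + 1)) * y₁ w ^ 2) w := by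
  have hd := ((h₁.pow 2).const_mul l).add
    (((hasDerivAt_id w).mul ((hasDerivAt_id w).const_sub 1)).mul (h₂.pow 2))
  refine hd.congr_deriv ?_
  simp
  linear_combination (2 * y₁ w) * ode

theorem abs_jacobiW_le_of_neg_half_le {a b : ℝ} (hab : 0 < a + b + 1) (hb : -(1 / 2) ≤ b) {n : ℕ}
    (hn : n ≠ 0) {w : ℝ} (hw : w ∈ Icc (0 : ℝ) (1 / 2)) :
    |jacobiW a b n w| ≤ exp (a + b + 1) * |jacobiW a b n 0| := by
  obtain ⟨y₁, y₂, h₁, h₂, ode⟩ := exists_deriv_jacobiW a b n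
  have hl : (0 : ℝ) < n * (n + a + b + 1) :=
    mul_pos (by positivity) (by linarith [n.cast_nonneg (α := ℝ)])
  set l : ℝ := n * (n + a + b + 1)
  set y := jacobiW a b n
  have hg := le_mul_exp_of_hasDerivAt_le (φ := fun x => 4 * (a + b + 1) * x)
    (φ' := fun _ => 4 * (a + b + 1)) hw.1
    (fun x _ => hasDerivAt_soninEnergy (h₁ x) (h₂ x) (ode x))
    (fun x _ => by simpa using (hasDerivAt_id x).const_mul (4 * (a + b + 1)))
    (fun x hx => by
      have hx1 : x ≤ 1 / 2 := hx.2.trans hw.2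
      have e1 : 0 ≤ (a + b + 1) * (x * (1 - 2 * x)) * y₁ x ^ 2 :=
        mul_nonneg (mul_nonneg hab.le (mul_nonneg hx.1 (by linarith))) (sq_nonneg _)
      have e2 : 0 ≤ (2 * b + 1) * y₁ x ^ 2 := mul_nonneg (by linarith) (sq_nonneg _)
      have e3 : 0 ≤ (a + b + 1) * (l * y x ^ 2) := by positivity
      nlinarith)
  simp only [mul_zero, zero_mul, add_zero, sub_zero] at hg
  have h3 : 0 ≤ w * (1 - w) * y₁ w ^ 2 :=
    mul_nonneg (mul_nonneg hw.1 (by linarith [hw.2])) (sq_nonneg _)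
  have h4 : exp (4 * (a + b + 1) * w) ≤ exp (a + b + 1) ^ 2 := by
    rw [← exp_nat_mul, exp_le_exp]
    push_cast
    nlinarith [hw.2]
  have h5 : l * y w ^ 2 ≤ l * (exp (a + b + 1) * |y 0|) ^ 2 := by
    rw [mul_pow, sq_abs]
    nlinarith [mul_le_mul_of_nonneg_left h4 (mul_nonneg hl.le (sq_nonneg (y 0)))]
  exact abs_le_of_sq_le_sq (le_of_mul_le_mul_left h5 hl) (by positivity)


theorem abs_mul_mul_le_energy {l w r u v : ℝ} (hw : 0 < w) (hw' : w ≤ 1 / 2)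
    (hrl : r ^ 2 = l * w) : |u * v| * r ≤ l * u ^ 2 + w * (1 - w) * v ^ 2 := by
  refine le_of_mul_le_mul_left ?_ hw
  have h1 : w * (l * u ^ 2 + w * (1 - w) * v ^ 2) =
      (r * |u|) ^ 2 + (1 - w) * (w * |v|) ^ 2 := by
    rw [mul_pow, mul_pow, sq_abs, sq_abs, hrl]; ring
  rw [h1, abs_mul]
  nlinarith [sq_nonneg (r * |u| - w * |v| / 2),
    mul_nonneg (sub_nonneg.2 hw') (sq_nonneg (w * |v|)), sq_nonneg (w * |v|)]

/-- Growth rate of the Sonin energy corrected by a cross term. -/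
theorem correctedEnergy_deriv_le {a b l w r y y₁ y₂ : ℝ} (hb : -1 < b) (hb' : b < -(1 / 2))
    (hab : 0 < a + b + 1) (hw : 0 < w) (hw' : w ≤ 1 / 2) (hr : 1 ≤ r) (hrl : r ^ 2 = l * w)
    (ode : w * (1 - w) * y₂ + (b + 1 - (a + b + 2) * w) * y₁ + l * y = 0) :
    (2 * (a + b + 1) * w - (2 * b + 1)) * y₁ ^ 2 + (2 * b + 1) / 2 * (y₁ * y₁ + y * y₂) ≤
      (-(2 * b + 1) / 2 / w + 2 * (1 + 4 * (a + b + 1)) + (1 / 2 + 2 * (a + b + 2)) / (r * w)) *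
        (l * y ^ 2 + w * (1 - w) * y₁ ^ 2 + (2 * b + 1) / 2 * (y * y₁)) := by
  have hr0 : 0 < r := by linarith
  have hY := abs_mul_mul_le_energy (u := y) (v := y₁) hw hw' hrl
  obtain ⟨s, hs⟩ : ∃ s, s = -(2 * b + 1) := ⟨_, rfl⟩
  have hl : 0 ≤ l := by nlinarith [sq_nonneg r]
  have hw1 : 0 < 1 - w := by linarith
  set F := l * y ^ 2 + w * (1 - w) * y₁ ^ 2 with hF
  set H := F + (2 * b + 1) / 2 * (y * y₁) with hH
  set q := b + 1 - (a + b + 2) * w with hq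
  have hqc : |q| ≤ a + b + 2 := by rw [abs_le]; constructor <;> nlinarith
  have hF0 : 0 ≤ F := by positivity
  have hs0 : 0 < s := by linarith
  have hs1 : s < 1 := by linarith
  have hYF : |y * y₁| ≤ F / r := by rwa [le_div_iff₀ hr0]
  have hFr : F / r ≤ F := div_le_self hF0 hr
  have hHs : F = H + s / 2 * (y * y₁) := by rw [hH, hs]; ring
  have hsY : s / 2 * (y * y₁) ≤ 1 / 2 * (F / r) :=
    (mul_le_mul_of_nonneg_left ((le_abs_self _).trans hYF) (by linarith)).trans
      (mul_le_mul_of_nonneg_right (by linarith) (by positivity))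
  have hF2 : F ≤ 2 * H := by linarith
  have hH0 : 0 ≤ H := by linarith
  have hFr2 : F / r ≤ 2 * H / r := by gcongr
  have hF3 : F ≤ H + H / r := by
    have : 2 * H / r = 2 * (H / r) := by ring
    linarith
  have hD : (2 * (a + b + 1) * w - (2 * b + 1)) * y₁ ^ 2 +
      (2 * b + 1) / 2 * (y₁ * y₁ + y * y₂) =
      s / 2 * F * (1 / w + 1 / (1 - w)) + 2 * (a + b + 1) * (w * y₁ ^ 2) +
        s / 2 * (q * (y * y₁)) * (1 / w + 1 / (1 - w)) := by
    rw [hF, hs]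
    field_simp
    linear_combination (2 * b + 1) * y * ode
  have hV : 1 / (1 - w) ≤ 2 := by rw [div_le_iff₀ hw1]; linarith
  have hV2 : 1 / w + 1 / (1 - w) ≤ 2 / w := by
    have : (2 : ℝ) ≤ 1 / w := by rw [le_div_iff₀ hw]; linarith
    have : 2 / w = 1 / w + 1 / w := by ring
    linarith
  have hV0 : 0 < 1 / w + 1 / (1 - w) := by positivity
  have hwy : w * y₁ ^ 2 ≤ 2 * F := by
    have e1 : 0 ≤ w * (1 - 2 * w) * y₁ ^ 2 :=
      mul_nonneg (mul_nonneg hw.le (by linarith)) (sq_nonneg _)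
    have e2 : 0 ≤ l * y ^ 2 := by positivity
    nlinarith
  clear_value H F q
  have t1 : s / 2 * F * (1 / w + 1 / (1 - w)) ≤
      s / 2 / w * H + 1 / 2 / (r * w) * H + 2 * H := by
    calc s / 2 * F * (1 / w + 1 / (1 - w)) ≤ s / 2 * F * (1 / w + 2) := by gcongr
      _ = s / 2 * (1 / w) * F + s * F := by ring
      _ ≤ s / 2 * (1 / w) * (H + H / r) + 1 * (2 * H) := by gcongr
      _ = s / 2 / w * H + s / 2 / (r * w) * H + 2 * H := by field_simp
      _ ≤ _ := by gcongr
  have t2 : 2 * (a + b + 1) * (w * y₁ ^ 2) ≤ 8 * (a + b + 1) * H := by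
    linarith [mul_le_mul_of_nonneg_left
      (hwy.trans (mul_le_mul_of_nonneg_left hF2 two_pos.le)) hab.le]
  have t3 : s / 2 * (q * (y * y₁)) * (1 / w + 1 / (1 - w)) ≤ 2 * (a + b + 2) / (r * w) * H := by
    have e : q * (y * y₁) ≤ (a + b + 2) * (2 * H / r) := by
      refine (le_abs_self _).trans ?_
      rw [abs_mul]
      exact mul_le_mul hqc (hYF.trans hFr2) (abs_nonneg _) (by linarith)
    have e0 : 0 ≤ (a + b + 2) * (2 * H / r) := by
      have : 0 < a + b + 2 := by linarith
      positivity
    calc s / 2 * (q * (y * y₁)) * (1 / w + 1 / (1 - w))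
        ≤ s / 2 * ((a + b + 2) * (2 * H / r)) * (1 / w + 1 / (1 - w)) := by gcongr
      _ ≤ 1 / 2 * ((a + b + 2) * (2 * H / r)) * (2 / w) := by gcongr
      _ = _ := by field_simp
  rw [hD, ← hs]
  have : (s / 2 / w + 2 * (1 + 4 * (a + b + 1)) + (1 / 2 + 2 * (a + b + 2)) / (r * w)) * H =
      (s / 2 / w * H + 1 / 2 / (r * w) * H + 2 * H) + 8 * (a + b + 1) * H +
        2 * (a + b + 2) / (r * w) * H := by ring
  linarith

theorem hasDerivAt_integratingFactor {l w : ℝ} (hl : 0 < l) (hw : 0 < w) (A B D : ℝ) :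
    HasDerivAt (fun w => A * log w + B * w - 2 * D / √(l * w))
      (A / w + B + D / (√(l * w) * w)) w := by
  have hlw : 0 < l * w := mul_pos hl hw
  have hsq : 0 < √(l * w) := Real.sqrt_pos.2 hlw
  have h1 := ((hasDerivAt_id w).const_mul l).sqrt (by simpa using hlw.ne')
  have h2 := (((Real.hasDerivAt_log hw.ne').const_mul A).add
    ((hasDerivAt_id w).const_mul B)).sub ((hasDerivAt_const w (2 * D)).div h1
      (by simpa using hsq.ne'))
  refine h2.congr_deriv ?_
  simp only [id, zero_mul, mul_one, zero_sub, Real.sq_sqrt hlw.le]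
  field_simp
  ring

/-- The Sonin energy on `[1 / l, 1 / 2]` grows at most like `l ^ (-(2 * b + 1) / 2)`. -/
theorem soninEnergy_le {a b l w : ℝ} {y y₁ y₂ : ℝ → ℝ} (hb : -1 < b) (hb' : b < -(1 / 2))
    (hab : 0 < a + b + 1) (hl : 2 ≤ l) (hw : w ∈ Icc (1 / l) (1 / 2))
    (h₁ : ∀ w, HasDerivAt y (y₁ w) w) (h₂ : ∀ w, HasDerivAt y₁ (y₂ w) w)
    (ode : ∀ w, w * (1 - w) * y₂ w + (b + 1 - (a + b + 2) * w) * y₁ w + l * y w = 0) :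
    l * y w ^ 2 ≤ 4 * (l * y (1 / l) ^ 2 + 1 / l * (1 - 1 / l) * y₁ (1 / l) ^ 2) *
      (exp (2 * (1 + 4 * (a + b + 1)) + 2 * (1 / 2 + 2 * (a + b + 2))) *
        l ^ (-(2 * b + 1) / 2)) := by
  have hl0 : 0 < l := by linarith
  have hpos : ∀ x ∈ Icc (1 / l) (1 / 2), 0 < x := fun x hx => (one_div_pos.2 hl0).trans_le hx.1
  have hr : ∀ x ∈ Icc (1 / l) (1 / 2), 1 ≤ √(l * x) := fun x hx => by
    rw [Real.one_le_sqrt, mul_comm, ← div_le_iff₀ hl0]; exact hx.1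
  have hrl : ∀ x ∈ Icc (1 / l) (1 / 2), √(l * x) ^ 2 = l * x := fun x hx =>
    Real.sq_sqrt (mul_pos hl0 (hpos x hx)).le
  have hY : ∀ x ∈ Icc (1 / l) (1 / 2), |y x * y₁ x| ≤ l * y x ^ 2 + x * (1 - x) * y₁ x ^ 2 :=
    fun x hx => by
      have := abs_mul_mul_le_energy (u := y x) (v := y₁ x) (hpos x hx) hx.2 (hrl x hx)
      nlinarith [hr x hx, abs_nonneg (y x * y₁ x)]
  have hg := le_mul_exp_of_hasDerivAt_le hw.1
    (fun x _ => (hasDerivAt_soninEnergy (h₁ x) (h₂ x) (ode x)).add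
      (((h₁ x).mul (h₂ x)).const_mul ((2 * b + 1) / 2)))
    (fun x hx => hasDerivAt_integratingFactor hl0 (hpos x ⟨hx.1, hx.2.trans hw.2⟩)
      (-(2 * b + 1) / 2) (2 * (1 + 4 * (a + b + 1))) (1 / 2 + 2 * (a + b + 2)))
    (fun x hx => by
      have hx' : x ∈ Icc (1 / l) (1 / 2) := ⟨hx.1, hx.2.trans hw.2⟩
      exact correctedEnergy_deriv_le hb hb' hab (hpos x hx') hx'.2 (hr x hx') (hrl x hx') (ode x))
  have hl' : 1 / l ∈ Icc (1 / l) (1 / 2) := ⟨le_rfl, hw.1.trans hw.2⟩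
  have hw0 := hpos w hw
  have hY0 := abs_le.1 (hY _ hl')
  have hYw := abs_le.1 (hY w hw)
  have hexp : exp ((-(2 * b + 1) / 2 * log w + 2 * (1 + 4 * (a + b + 1)) * w -
      2 * (1 / 2 + 2 * (a + b + 2)) / √(l * w)) -
      (-(2 * b + 1) / 2 * log (1 / l) + 2 * (1 + 4 * (a + b + 1)) * (1 / l) -
      2 * (1 / 2 + 2 * (a + b + 2)) / √(l * (1 / l)))) ≤
      exp (2 * (1 + 4 * (a + b + 1)) + 2 * (1 / 2 + 2 * (a + b + 2))) *
        l ^ (-(2 * b + 1) / 2) := by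
    rw [rpow_def_of_pos hl0, ← exp_add, exp_le_exp, mul_one_div_cancel hl0.ne', Real.sqrt_one,
      one_div l, Real.log_inv]
    have e1 : log w ≤ 0 := Real.log_nonpos hw0.le (by linarith [hw.2])
    have e2 : 0 ≤ 2 * (1 / 2 + 2 * (a + b + 2)) / √(l * w) :=
      div_nonneg (by linarith) (Real.sqrt_nonneg _)
    have e3 : 0 < l⁻¹ := by positivity
    nlinarith [hw.2]
  have hFw : 0 ≤ w * (1 - w) * y₁ w ^ 2 :=
    mul_nonneg (mul_nonneg hw0.le (by linarith [hw.2])) (sq_nonneg _)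
  simp only [Pi.add_apply, Pi.mul_apply] at hg
  set F0 := l * y (1 / l) ^ 2 + 1 / l * (1 - 1 / l) * y₁ (1 / l) ^ 2
  set Fw := l * y w ^ 2 + w * (1 - w) * y₁ w ^ 2 with hFwdef
  have hF0 : 0 ≤ F0 := by linarith
  have k1 : Fw ≤ 2 * (Fw + (2 * b + 1) / 2 * (y w * y₁ w)) := by nlinarith
  have k2 : F0 + (2 * b + 1) / 2 * (y (1 / l) * y₁ (1 / l)) ≤ 2 * F0 := by nlinarith
  calc l * y w ^ 2 ≤ Fw := by linarith
    _ ≤ 2 * (Fw + (2 * b + 1) / 2 * (y w * y₁ w)) := k1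
    _ ≤ 2 * (2 * F0 * (exp (2 * (1 + 4 * (a + b + 1)) + 2 * (1 / 2 + 2 * (a + b + 2))) *
        l ^ (-(2 * b + 1) / 2))) := by
      refine mul_le_mul_of_nonneg_left (hg.trans ?_) zero_le_two
      exact mul_le_mul k2 hexp (exp_pos _).le (by positivity)
    _ = _ := by ring

/-- Bound for the derivative of `P_n^{(a,b)}` in the variable `(1 + x) / 2`. -/
theorem exists_abs_deriv_jacobiW_le {a b : ℝ} (hab : 0 < a + b + 1) (hb : -1 < b) :
    ∃ D : ℝ, 0 < D ∧ ∀ n : ℕ, 2 ≤ n → ∀ w ∈ Icc (0 : ℝ) (1 / 2), ∀ d,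
      HasDerivAt (jacobiW a b n) d w → |d| ≤ D * ((n : ℝ) ^ b * n ^ 2) := by
  refine ⟨(a + b + 2) * (exp (a + b + 3) * exp |b + 1|), by
    have : 0 < a + b + 2 := by linarith
    positivity, fun n hn w hw d hd => ?_⟩
  obtain ⟨m, rfl⟩ : ∃ m, n = m + 1 := ⟨n - 1, by omega⟩
  have hm : m ≠ 0 := by omega
  have hm0 : (0 : ℝ) ≤ m := m.cast_nonneg
  rw [hd.unique (hasDerivAt_jacobiW a b m w), abs_mul, abs_of_nonneg (by linarith)]
  have h1 : |jacobiW (a + 1) (b + 1) m w| ≤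
      exp (a + b + 3) * (exp |b + 1| * ((m + 1 : ℕ) : ℝ) ^ (b + 1)) := by
    have e := abs_jacobiW_le_of_neg_half_le (a := a + 1) (b := b + 1) (by linarith) (by linarith)
      hm hw
    rw [show a + 1 + (b + 1) + 1 = a + b + 3 by ring] at e
    refine e.trans ?_
    gcongr
    refine (abs_jacobiW_zero_le (by linarith) (by linarith) hm).trans ?_
    gcongr
    · linarith
    · linarith
  have h2 : (m : ℝ) + 1 + a + b + 1 ≤ (a + b + 2) * ((m + 1 : ℕ) : ℝ) := by
    push_cast; nlinarith
  have hn0 : (0 : ℝ) < ((m + 1 : ℕ) : ℝ) := by positivity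
  calc _ ≤ (a + b + 2) * ((m + 1 : ℕ) : ℝ) *
        (exp (a + b + 3) * (exp |b + 1| * ((m + 1 : ℕ) : ℝ) ^ (b + 1))) :=
        mul_le_mul h2 h1 (abs_nonneg _) (mul_nonneg (by linarith) hn0.le)
    _ = _ := by rw [rpow_add_one hn0.ne']; ring

theorem exists_abs_jacobiW_le_of_lt_neg_half {a b : ℝ} (hab : 0 < a + b + 1) (hb : -1 < b)
    (hb' : b < -(1 / 2)) :
    ∃ C : ℝ, 0 < C ∧ ∀ n : ℕ, 2 ≤ n → ∀ w ∈ Icc (0 : ℝ) (1 / 2),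
      |jacobiW a b n w| ≤ C * (n : ℝ) ^ (-(1 / 2) : ℝ) := by
  obtain ⟨D, hD, hder⟩ := exists_abs_deriv_jacobiW_le hab hb
  set A := exp |b| + D with hA
  set K := exp (2 * (1 + 4 * (a + b + 1)) + 2 * (1 / 2 + 2 * (a + b + 2)))
  set s := -(2 * b + 1) / 2 with hs
  have hA0 : 0 < A := by positivity
  have hK0 : 0 < K := exp_pos _
  have hκ : 0 < a + b + 2 := by linarith
  refine ⟨A + √(8 * A ^ 2 * K * (a + b + 2) ^ s), by positivity, fun n hn w hw => ?_⟩
  have hn2 : (2 : ℝ) ≤ n := by exact_mod_cast hn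
  have hn0 : (0 : ℝ) < n := by linarith
  obtain ⟨y₁, y₂, h₁, h₂, ode⟩ := exists_deriv_jacobiW a b n
  set l : ℝ := n * (n + a + b + 1) with hl
  have hln : (n : ℝ) ^ 2 ≤ l := by nlinarith
  have hln' : l ≤ (a + b + 2) * n ^ 2 := by
    have : 0 ≤ (a + b + 1) * (n * (n - 1)) := by
      refine mul_nonneg hab.le (mul_nonneg hn0.le (by linarith))
    nlinarith
  have hl2 : 2 ≤ l := by nlinarith
  have hl0 : 0 < l := by linarith
  set y := jacobiW a b n with hy
  set N : ℝ := (n : ℝ) ^ b with hN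
  have hN0 : 0 < N := rpow_pos_of_pos hn0 b
  have hsmall : ∀ x ∈ Icc (0 : ℝ) (1 / l), |y x| ≤ A * N := by
    intro x hx
    have hsub : ∀ z ∈ Icc (0 : ℝ) x, |y₁ z| ≤ D * (N * n ^ 2) := fun z hz =>
      hder n hn z ⟨hz.1, (hz.2.trans hx.2).trans
        (one_div_le_one_div_of_le two_pos hl2)⟩ _ (h₁ z)
    have hmv := (convex_Icc (0 : ℝ) x).norm_image_sub_le_of_norm_hasDerivWithin_le
      (fun z _ => (h₁ z).hasDerivWithinAt) hsub (left_mem_Icc.2 hx.1) (right_mem_Icc.2 hx.1)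
    rw [Real.norm_eq_abs, Real.norm_eq_abs, sub_zero, abs_of_nonneg hx.1] at hmv
    have hxn : n ^ 2 * x ≤ 1 := by
      calc n ^ 2 * x ≤ l * (1 / l) := mul_le_mul hln hx.2 hx.1 hl0.le
        _ = 1 := mul_one_div_cancel hl0.ne'
    have h0 := abs_jacobiW_zero_le hab hb (show n ≠ 0 by omega)
    have h3 : D * (N * n ^ 2) * x ≤ D * N := by
      nlinarith [mul_le_mul_of_nonneg_left hxn (mul_pos hD hN0).le]
    have h4 := abs_sub_abs_le_abs_sub (y x) (y 0)
    rw [hA, add_mul]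
    linarith
  have hC0 : 0 ≤ √(8 * A ^ 2 * K * (a + b + 2) ^ s) := Real.sqrt_nonneg _
  rcases le_total w (1 / l) with hwl | hwl
  · refine (hsmall w ⟨hw.1, hwl⟩).trans ?_
    exact mul_le_mul (by linarith) (rpow_le_rpow_of_exponent_le (by linarith) hb'.le) hN0.le
      (by linarith)
  · have hE := soninEnergy_le hb hb' hab hl2 ⟨hwl, hw.2⟩ h₁ h₂ ode
    have hl1 : 0 < 1 / l := one_div_pos.2 hl0
    have e1 := hsmall (1 / l) ⟨hl1.le, le_rfl⟩
    have e2 := hder n hn (1 / l) ⟨hl1.le, one_div_le_one_div_of_le two_pos hl2⟩ _ (h₁ _)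
    have f1 : y (1 / l) ^ 2 ≤ (A * N) ^ 2 := by rw [← sq_abs]; gcongr
    have f2 : 1 / l * (1 - 1 / l) * y₁ (1 / l) ^ 2 ≤ l * (A * N) ^ 2 := by
      have hDA : D ≤ A := by rw [hA]; linarith [exp_pos |b|]
      calc 1 / l * (1 - 1 / l) * y₁ (1 / l) ^ 2 ≤ 1 / l * 1 * (A * (N * l)) ^ 2 := by
            rw [← sq_abs (y₁ _)]
            gcongr
            · linarith
            · exact e2.trans (by gcongr)
        _ = _ := by field_simp
    have f3 : l * y w ^ 2 ≤ l * (8 * (A * N) ^ 2 * (K * l ^ s)) := by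
      refine hE.trans ?_
      calc _ ≤ 4 * (l * (A * N) ^ 2 + l * (A * N) ^ 2) * (K * l ^ s) := by gcongr
        _ = _ := by ring
    have f4 : l ^ s ≤ (a + b + 2) ^ s * (n : ℝ) ^ (-(2 * b + 1)) := by
      calc l ^ s ≤ ((a + b + 2) * n ^ 2) ^ s := rpow_le_rpow hl0.le hln' (by linarith)
        _ = _ := by
          rw [mul_rpow hκ.le (by positivity), ← rpow_natCast (n : ℝ) 2, ← rpow_mul hn0.le, hs]
          congr 2
          push_cast
          ring
    have f5 : N ^ 2 * (n : ℝ) ^ (-(2 * b + 1)) = ((n : ℝ) ^ (-(1 / 2) : ℝ)) ^ 2 := by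
      rw [hN, ← rpow_natCast ((n : ℝ) ^ b) 2, ← rpow_natCast ((n : ℝ) ^ (-(1 / 2) : ℝ)) 2,
        ← rpow_mul hn0.le, ← rpow_mul hn0.le, ← rpow_add hn0]
      congr 1
      push_cast
      ring
    have f6 : y w ^ 2 ≤ (√(8 * A ^ 2 * K * (a + b + 2) ^ s) * (n : ℝ) ^ (-(1 / 2) : ℝ)) ^ 2 := by
      rw [mul_pow, Real.sq_sqrt (by positivity), ← f5]
      calc y w ^ 2 ≤ 8 * (A * N) ^ 2 * (K * l ^ s) := le_of_mul_le_mul_left f3 hl0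
        _ ≤ 8 * (A * N) ^ 2 * (K * ((a + b + 2) ^ s * (n : ℝ) ^ (-(2 * b + 1)))) := by gcongr
        _ = _ := by ring
    refine (abs_le_of_sq_le_sq f6 (by positivity)).trans ?_
    gcongr
    linarith

theorem exists_abs_jacobiW_le {a b : ℝ} (hab : 0 < a + b + 1) (hb : -1 < b) :
    ∃ C : ℝ, 0 < C ∧ ∀ n : ℕ, 2 ≤ n → ∀ w ∈ Icc (0 : ℝ) (1 / 2),
      |jacobiW a b n w| ≤ C * (n : ℝ) ^ (max b (-(1 / 2) : ℝ)) := by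
  rcases lt_or_ge b (-(1 / 2)) with h | h
  · rw [max_eq_right h.le]
    exact exists_abs_jacobiW_le_of_lt_neg_half hab hb h
  · rw [max_eq_left h]
    refine ⟨exp (a + b + 1) * exp |b|, by positivity, fun n hn w hw => ?_⟩
    rw [mul_assoc]
    exact (abs_jacobiW_le_of_neg_half_le hab h (by omega) hw).trans
      (mul_le_mul_of_nonneg_left (abs_jacobiW_zero_le hab hb (by omega)) (exp_pos _).le)

theorem jacobiP_sin_half_bound_second (a b : ℝ) (ha : 1 / 2 < a) (hb : -1 < b) :
    ∃ C : ℝ, 0 < C ∧ ∃ n₀ : ℕ, ∀ n : ℕ, n₀ ≤ n →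
      ∀ θ ∈ Set.Icc (π / 2) π,
        Real.sin (θ / 2) * |jacobiP a b n (Real.cos θ)| ≤
          C * (n : ℝ) ^ (max b (-(1 / 2) : ℝ)) := by
  obtain ⟨C, hC, h⟩ := exists_abs_jacobiW_le (a := a) (b := b) (by linarith) hb
  refine ⟨C, hC, 2, fun n hn θ hθ => ?_⟩
  have hcos : Real.cos θ ≤ 0 :=
    Real.cos_nonpos_of_pi_div_two_le_of_le hθ.1 (by linarith [hθ.2, Real.pi_pos])
  have hw := h n hn ((1 + Real.cos θ) / 2) ⟨by linarith [Real.neg_one_le_cos θ], by linarith⟩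
  rw [jacobiW, show (1 + Real.cos θ) / 2 - 1 = (Real.cos θ - 1) / 2 by ring,
    ← jacobiP_eq_eval] at hw
  exact (mul_le_of_le_one_left (abs_nonneg _) (Real.sin_le_one _)).trans hw
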